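/- Let K be a difference subfield of U with σ(K) = K and a a finite tuple with σ(a) ∈ K(a)^alg. Then dd(a/K) is a positive integer which divides ld(a/K). -/

import Mathlib

/- Setting: a large algebraically closed field `U` with an automorphism `σ`.
   Tuples are maps `Fin n → U`; for a tuple `t`, the relevant set of coordinates
   is `Set.range t`.  `fAdj E s` is the subfield `E(s)` generated by a subfield
   `E` and a set `s`, and `deg E s` is the degree `μ(s/E) = [E(s):E]`. -/

set_option maxHeartbeats 1000000
set_option synthInstance.maxHeartbeats 1000000

open Filter Set

variable {U : Type*}

/-- The subfield `E(s)` generated by the subfield `E` and the set `s`. -/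
noncomputable def fAdj [Field U] (E : Subfield U) (s : Set U) : Subfield U :=
  (IntermediateField.adjoin E s).toSubfield

/-- The degree `μ(s/E) = [E(s):E]` (as `Module.finrank`; it is `0` when infinite). -/
noncomputable def deg [Field U] (E : Subfield U) (s : Set U) : ℕ :=
  Module.finrank E (IntermediateField.adjoin E s)

/-- `k ↦ μ(σ^{k+1}(s) / K(s, σ(s), …, σ^k(s)))`: the sequence whose eventual
value is the limit degree `ld(s/K)`. -/
noncomputable def ldSeq [Field U] (σ : U ≃+* U) (K : Subfield U) (s : Set U) (k : ℕ) : ℕ :=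
  deg (fAdj K (⋃ i ∈ Set.Iic k, ⇑(σ ^ i) '' s)) (⇑(σ ^ (k + 1)) '' s)

/-- `k ↦ μ(σ^k(s) / K(s))`: the sequence whose `k`-th roots converge to the
distant degree `dd(s/K)`. -/
noncomputable def ddSeq [Field U] (σ : U ≃+* U) (K : Subfield U) (s : Set U) (k : ℕ) : ℕ :=
  deg (fAdj K s) (⇑(σ ^ k) '' s)

/-- The inversive closure `K^inv = ⋃ₙ σ^{-n}(K)`. -/
noncomputable def Kinv [Field U] (σ : U ≃+* U) (K : Subfield U) : Subfield U :=
  ⨆ n : ℕ, K.map (σ⁻¹ ^ n : U ≃+* U).toRingHom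

/-- The difference field `K(s)_σ = K(σ^i(s) : i ∈ ℕ)` generated by `s` over `K`. -/
noncomputable def diffAdj [Field U] (σ : U ≃+* U) (K : Subfield U) (s : Set U) : Subfield U :=
  fAdj K (⋃ i : ℕ, ⇑(σ ^ i) '' s)

namespace Subfield

section Relfinrank

variable [Field U] {A B C D : Subfield U}

theorem relfinrank_ne_zero_of_le_of_le (hAB : A ≤ B) (hBC : B ≤ C) (h : A.relfinrank C ≠ 0) :
    A.relfinrank B ≠ 0 ∧ B.relfinrank C ≠ 0 := by
  rw [← relfinrank_mul_relfinrank hAB hBC] at h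
  exact ⟨left_ne_zero_of_mul h, right_ne_zero_of_mul h⟩

theorem relfinrank_le_of_le_right (hAB : A ≤ B) (hBC : B ≤ C) (h : A.relfinrank C ≠ 0) :
    A.relfinrank B ≤ A.relfinrank C :=
  Nat.le_of_dvd (Nat.pos_of_ne_zero h) ⟨_, (relfinrank_mul_relfinrank hAB hBC).symm⟩

theorem relrank_sup_le (hAB : A ≤ B) (hAC : A ≤ C) (h : A.relfinrank B ≠ 0) :
    C.relrank (B ⊔ C) ≤ A.relrank B := by
  have hfin : FiniteDimensional A (extendScalars hAB) := by
    rw [relfinrank_eq_finrank_of_le hAB] at h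
    exact Module.finite_of_finrank_pos (Nat.pos_of_ne_zero h)
  let : Algebra A C := (inclusion hAC).toAlgebra
  have : IsScalarTower A C U := IsScalarTower.of_algebraMap_eq fun _ => rfl
  have key := IntermediateField.adjoin_rank_le_of_isAlgebraic_right C (extendScalars hAB)
  rw [relrank_eq_rank_of_le hAB, relrank_eq_rank_of_le le_sup_right]
  suffices hE : extendScalars (le_sup_right : C ≤ B ⊔ C) =
      IntermediateField.adjoin C (extendScalars hAB : Set U) by rwa [hE]
  rw [← IntermediateField.toSubfield_inj, extendScalars_toSubfield,
    IntermediateField.adjoin_toSubfield, closure_union, coe_extendScalars, closure_eq, sup_comm]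
  congr 1
  rw [show Set.range (algebraMap C U) = (C : Set U) from Subtype.range_coe, closure_eq]

theorem relfinrank_baseChange (hAB : A ≤ B) (hAC : A ≤ C) (hCD : C ≤ D) (hD : D ≤ B ⊔ C)
    (h : A.relfinrank B ≠ 0) :
    C.relfinrank D ≠ 0 ∧ C.relfinrank D ≤ A.relfinrank B := by
  have hlt : A.relrank B < Cardinal.aleph0 := by
    by_contra hle
    exact h (Cardinal.toNat_apply_of_aleph0_le (not_lt.mp hle))
  have hle := relrank_sup_le hAB hAC h
  have hsup : C.relfinrank (B ⊔ C) ≠ 0 := by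
    refine (Cardinal.toNat_ne_zero).mpr ⟨?_, hle.trans_lt hlt⟩
    exact rank_pos.ne'
  exact ⟨(relfinrank_ne_zero_of_le_of_le hCD hD hsup).1,
    (relfinrank_le_of_le_right hCD hD hsup).trans (Cardinal.toNat_le_toNat hle hlt)⟩

end Relfinrank

section Compositum

variable [Field U]

/-- The compositum `A · σ(A) ⋯ σᵏ(A)`. -/
def compositum (σ : U →+* U) (A : Subfield U) : ℕ → Subfield U
  | 0 => A
  | k + 1 => A ⊔ (compositum σ A k).map σ

variable (σ : U →+* U) (A : Subfield U) {B : Subfield U}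

theorem iterate_map_succ (k : ℕ) : (map σ)^[k + 1] A = ((map σ)^[k] A).map σ :=
  Function.iterate_succ_apply' _ _ _

theorem map_le_map {A B : Subfield U} (h : A ≤ B) : A.map σ ≤ B.map σ :=
  (gc_map_comap σ).monotone_l h

theorem iterate_map_mono (h : A ≤ B) (k : ℕ) : (map σ)^[k] A ≤ (map σ)^[k] B :=
  Monotone.iterate (f := map σ) (gc_map_comap σ).monotone_l k h

theorem relfinrank_iterate_map (k : ℕ) :
    ((map σ)^[k] A).relfinrank ((map σ)^[k] B) = A.relfinrank B := by
  induction k with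
  | zero => rfl
  | succ k ih => rw [iterate_map_succ, iterate_map_succ, relfinrank_map_map, ih]

theorem iterate_map_sup (k : ℕ) :
    (map σ)^[k] (A ⊔ B) = (map σ)^[k] A ⊔ (map σ)^[k] B := by
  induction k with
  | zero => rfl
  | succ k ih => rw [iterate_map_succ, ih, map_sup, ← iterate_map_succ, ← iterate_map_succ]

theorem compositum_succ (k : ℕ) :
    compositum σ A (k + 1) = compositum σ A k ⊔ (map σ)^[k + 1] A := by
  induction k with
  | zero => rfl
  | succ k ih =>
    rw [compositum, ih, map_sup, ← sup_assoc, ← iterate_map_succ, ← ih]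
    rfl

theorem compositum_mono : Monotone (compositum σ A) :=
  monotone_nat_of_le_succ fun k => by rw [compositum_succ]; exact le_sup_left

theorem le_compositum (k : ℕ) : A ≤ compositum σ A k :=
  compositum_mono σ A (Nat.zero_le k)

theorem iterate_map_le_compositum {j k : ℕ} (h : j ≤ k) :
    (map σ)^[j] A ≤ compositum σ A k := by
  refine le_trans ?_ (compositum_mono σ A h)
  cases j with
  | zero => exact le_rfl
  | succ j => rw [compositum_succ]; exact le_sup_right

theorem compositum_compositum (i k : ℕ) :
    compositum σ (compositum σ A i) k = compositum σ A (k + i) := by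
  induction k with
  | zero => rw [Nat.zero_add]; rfl
  | succ k ih =>
    rw [compositum, ih, Nat.add_right_comm]
    apply le_antisymm
    · exact sup_le (compositum_mono σ A (by omega)) le_sup_right
    · exact sup_le_sup_right (le_compositum σ A i) _

theorem relfinrank_compositum_succ_ne_zero (h : A.relfinrank (A ⊔ A.map σ) ≠ 0) (k : ℕ) :
    (compositum σ A k).relfinrank (compositum σ A (k + 1)) ≠ 0 := by
  rw [← relfinrank_iterate_map (B := A ⊔ A.map σ) σ A k] at h
  refine (relfinrank_baseChange (iterate_map_mono σ A le_sup_left k)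
    (iterate_map_le_compositum σ A le_rfl) (compositum_mono σ A k.le_succ) ?_ h).1
  rw [compositum_succ, iterate_map_sup, ← Function.iterate_succ_apply]
  exact sup_le le_sup_right (le_sup_right.trans le_sup_left)

theorem relfinrank_compositum_ne_zero (h : A.relfinrank (A ⊔ A.map σ) ≠ 0) (k : ℕ) :
    A.relfinrank (compositum σ A k) ≠ 0 := by
  induction k with
  | zero => exact (relfinrank_self A).trans_ne one_ne_zero
  | succ k ih =>
    rw [← relfinrank_mul_relfinrank (le_compositum σ A k) (compositum_mono σ A k.le_succ)]
    exact mul_ne_zero ih (relfinrank_compositum_succ_ne_zero σ A h k)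

theorem relfinrank_sup_iterate_map_ne_zero (h : A.relfinrank (A ⊔ A.map σ) ≠ 0) (k : ℕ) :
    A.relfinrank (A ⊔ (map σ)^[k] A) ≠ 0 :=
  (relfinrank_ne_zero_of_le_of_le le_sup_left
    (sup_le (le_compositum σ A k) (iterate_map_le_compositum σ A le_rfl))
    (relfinrank_compositum_ne_zero σ A h k)).1

section Stable

variable {d : ℕ} (hd : d ≠ 0)
  (hstab : ∀ k, (compositum σ A k).relfinrank (compositum σ A (k + 1)) = d)

include hstab

theorem relfinrank_compositum_add (i m : ℕ) :
    (compositum σ A i).relfinrank (compositum σ A (i + m)) = d ^ m := by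
  induction m with
  | zero => exact relfinrank_self _
  | succ m ih =>
    rw [← Nat.add_assoc, ← relfinrank_mul_relfinrank
      (compositum_mono σ A (Nat.le_add_right i m)) (compositum_mono σ A (i + m).le_succ),
      ih, hstab, pow_succ]

include hd

/-- `A` is linearly disjoint from `σ(A) ⋯ σᵐ⁺¹(A)` over `σ(A)`, so adjoining `A` does not lower
degrees. -/
theorem relfinrank_le_relfinrank_sup {X Y : Subfield U} {m : ℕ} (hX : A.map σ ≤ X) (hXY : X ≤ Y)
    (hY : Y ≤ (compositum σ A m).map σ) :
    X.relfinrank Y ≤ (A ⊔ X).relfinrank (A ⊔ Y) := by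
  set B := A.map σ
  set H := (compositum σ A m).map σ
  have hBH : B.relfinrank H = d ^ m := by
    rw [relfinrank_map_map]
    simpa [compositum] using relfinrank_compositum_add σ A hstab 0 m
  have hABH : (A ⊔ B).relfinrank (A ⊔ H) = d ^ m := by
    have := relfinrank_compositum_add σ A hstab 1 m
    rwa [Nat.add_comm 1 m] at this
  have hne : B.relfinrank H ≠ 0 := hBH ▸ pow_ne_zero _ hd
  have hXH := (relfinrank_ne_zero_of_le_of_le hX (hXY.trans hY) hne)
  have hBY := (relfinrank_ne_zero_of_le_of_le (hX.trans hXY) hY hne)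
  have h₁ := (relfinrank_baseChange (C := A ⊔ B) (D := A ⊔ X) hX le_sup_right
    (sup_le_sup_left hX _) (sup_le (le_sup_left.trans le_sup_right) le_sup_left) hXH.1).2
  have h₂ := (relfinrank_baseChange (C := A ⊔ Y) (D := A ⊔ H) hY le_sup_right
    (sup_le_sup_left hY _) (sup_le (le_sup_left.trans le_sup_right) le_sup_left) hBY.2).2
  by_contra! hlt
  have hpos : 0 < B.relfinrank X * Y.relfinrank H :=
    Nat.pos_of_ne_zero (mul_ne_zero hXH.1 hBY.2)
  have e₁ : B.relfinrank X * X.relfinrank Y * Y.relfinrank H = d ^ m := by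
    rw [relfinrank_mul_relfinrank hX hXY, relfinrank_mul_relfinrank (hX.trans hXY) hY, hBH]
  have e₂ : (A ⊔ B).relfinrank (A ⊔ X) * (A ⊔ X).relfinrank (A ⊔ Y) *
      (A ⊔ Y).relfinrank (A ⊔ H) = d ^ m := by
    rw [relfinrank_mul_relfinrank (sup_le_sup_left hX _) (sup_le_sup_left hXY _),
      relfinrank_mul_relfinrank (sup_le_sup_left (hX.trans hXY) _) (sup_le_sup_left hY _), hABH]
  have : (A ⊔ B).relfinrank (A ⊔ X) * (A ⊔ X).relfinrank (A ⊔ Y) * (A ⊔ Y).relfinrank (A ⊔ H) ≤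
      B.relfinrank X * (A ⊔ X).relfinrank (A ⊔ Y) * Y.relfinrank H := by gcongr
  nlinarith

theorem relfinrank_sup_iterate_map_succ (k : ℕ) :
    (A ⊔ (map σ)^[k] A).relfinrank (A ⊔ (map σ)^[k] A ⊔ (map σ)^[k + 1] A) = d := by
  have hd' : A.relfinrank (A ⊔ A.map σ) = d := hstab 0
  have hk := relfinrank_iterate_map (B := A ⊔ A.map σ) σ A k
  rw [iterate_map_sup, ← Function.iterate_succ_apply, hd'] at hk
  have hle := relfinrank_baseChange (C := A ⊔ (map σ)^[k] A)
    (D := A ⊔ (map σ)^[k] A ⊔ (map σ)^[k + 1] A) le_sup_left le_sup_right le_sup_left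
    (sup_le le_sup_right (le_sup_right.trans le_sup_left)) (hk ▸ hd)
  refine le_antisymm (hle.2.trans_eq hk) ?_
  rw [← hstab k]
  refine (relfinrank_baseChange le_sup_left
    (sup_le (le_compositum σ A k) (iterate_map_le_compositum σ A le_rfl))
    (compositum_mono σ A k.le_succ) ?_ hle.1).2
  rw [compositum_succ]
  exact sup_le le_sup_right (le_sup_right.trans le_sup_left)

theorem relfinrank_sup_iterate_map_monotone :
    Monotone fun k => (A ⊔ (map σ)^[k + 1] A).relfinrank
      (A ⊔ (map σ)^[k] A ⊔ (map σ)^[k + 1] A) := by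
  refine monotone_nat_of_le_succ fun k => ?_
  rw [← relfinrank_map_map _ _ σ]
  have hle : A ⊔ (map σ)^[k + 1] A ≤ A ⊔ (map σ)^[k] A ⊔ (map σ)^[k + 1] A :=
    sup_le_sup_right le_sup_left _
  have hH : A ⊔ (map σ)^[k] A ⊔ (map σ)^[k + 1] A ≤ compositum σ A (k + 1) :=
    sup_le (sup_le (le_compositum σ A _) (iterate_map_le_compositum σ A k.le_succ))
      (iterate_map_le_compositum σ A le_rfl)
  refine (relfinrank_le_relfinrank_sup σ A hd hstab (map_le_map σ le_sup_left)
    (map_le_map σ hle) (map_le_map σ hH)).trans ?_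
  have hne : (A ⊔ (map σ)^[k + 1 + 1] A).relfinrank
      (A ⊔ (map σ)^[k + 1] A ⊔ (map σ)^[k + 1 + 1] A) ≠ 0 := by
    have h₁ := relfinrank_compositum_ne_zero σ A ((hstab 0).trans_ne hd) (k + 1 + 1)
    have h₂ := (relfinrank_ne_zero_of_le_of_le le_sup_left
      (sup_le (le_compositum σ A _) (iterate_map_le_compositum σ A le_rfl)) h₁).2
    exact (relfinrank_ne_zero_of_le_of_le (sup_le_sup_right le_sup_left _)
      (sup_le (sup_le (le_compositum σ A _) (iterate_map_le_compositum σ A (Nat.le_succ _)))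
        (iterate_map_le_compositum σ A le_rfl)) h₂).1
  refine (relfinrank_baseChange (sup_le_sup_right le_sup_left _) ?_
    (sup_le_sup_left (map_le_map σ hle) _) ?_ hne).2
  · rw [map_sup, ← iterate_map_succ]
    exact sup_le_sup_left le_sup_right _
  · rw [map_sup, map_sup, map_sup, ← iterate_map_succ, ← iterate_map_succ]
    refine sup_le (le_sup_left.trans le_sup_right) (sup_le (sup_le ?_ ?_) ?_)
    · exact le_sup_left.trans (le_sup_right.trans le_sup_right)
    · exact le_sup_right.trans (le_sup_left.trans le_sup_left)
    · exact le_sup_right.trans le_sup_left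

end Stable

end Compositum

end Subfield

theorem Nat.dvd_of_forall_pow_dvd_pow_mul {c d N : ℕ} (hN : N ≠ 0) (hd : d ≠ 0)
    (h : ∀ j, c ^ j ∣ d ^ j * N) : c ∣ d := by
  obtain ⟨g, c', d', hg, hcop, rfl, rfl⟩ :=
    Nat.exists_coprime' (m := c) (n := d) (Nat.gcd_pos_of_pos_right _ (Nat.pos_of_ne_zero hd))
  have hdvd (j : ℕ) : c' ^ j ∣ N := by
    have := h j
    rw [mul_pow, mul_pow, mul_right_comm] at this
    exact (hcop.pow j j).dvd_of_dvd_mul_left (Nat.dvd_of_mul_dvd_mul_right (pow_pos hg j) this)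
  have hc' : c' ≤ 1 := by
    by_contra! hlt
    exact absurd (Nat.le_of_dvd (Nat.pos_of_ne_zero hN) (hdvd N))
      (not_le.mpr (Nat.lt_pow_self hlt))
  have hc0 : c' ≠ 0 := by
    rintro rfl
    exact hN (by simpa using hdvd 1)
  obtain rfl : c' = 1 := by omega
  rw [one_mul]
  exact dvd_mul_left _ _

/-- If the integers `d * D k / D (k + 1)` increase with `k`, then `D` is eventually geometric with
an integral ratio dividing `d`. -/
theorem Nat.eventually_geometric_of_monotone {D c : ℕ → ℕ} {d : ℕ} (hd : d ≠ 0)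
    (hD : ∀ k, D k ≠ 0) (hc : Monotone c) (h : ∀ k, d * D k = c k * D (k + 1)) :
    ∃ m, 0 < m ∧ m ∣ d ∧ ∃ k₀, ∀ j, D (k₀ + j) = m ^ j * D k₀ := by
  have hle (k : ℕ) : c k ≤ d := by
    by_contra! hlt
    have hdec (j : ℕ) : D (k + j) + j ≤ D k := by
      induction j with
      | zero => exact le_rfl
      | succ j ih =>
        have h1 := h (k + j)
        have h2 := hlt.trans_le (hc (Nat.le_add_right k j))
        have : D (k + j + 1) < D (k + j) := by
          by_contra! hge
          have := Nat.pos_of_ne_zero (hD (k + j))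
          nlinarith
        rw [← Nat.add_assoc k j 1]
        omega
    have := hdec (D k + 1)
    omega
  obtain ⟨k₀, hk₀⟩ : ∃ k₀, ∀ k, c k ≤ c k₀ := by
    obtain ⟨k₀, hk₀⟩ := Nat.sSup_mem (range_nonempty c) ⟨d, forall_mem_range.mpr hle⟩
    exact ⟨k₀, fun k => hk₀ ▸ le_csSup ⟨d, forall_mem_range.mpr hle⟩ (mem_range_self k)⟩
  have hconst (j : ℕ) : c (k₀ + j) = c k₀ := le_antisymm (hk₀ _) (hc (Nat.le_add_right _ _))
  have hgeom (j : ℕ) : d ^ j * D k₀ = c k₀ ^ j * D (k₀ + j) := by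
    induction j with
    | zero => rfl
    | succ j ih =>
      have h1 := h (k₀ + j)
      rw [hconst] at h1
      calc d ^ (j + 1) * D k₀ = d * (d ^ j * D k₀) := by ring
        _ = c k₀ ^ j * (d * D (k₀ + j)) := by rw [ih]; ring
        _ = c k₀ ^ (j + 1) * D (k₀ + (j + 1)) := by rw [h1, ← Nat.add_assoc]; ring
  obtain ⟨m, rfl⟩ := Nat.dvd_of_forall_pow_dvd_pow_mul (hD k₀) hd
    fun j => ⟨_, hgeom j⟩
  refine ⟨m, Nat.pos_of_ne_zero (right_ne_zero_of_mul hd), dvd_mul_left _ _, k₀, fun j => ?_⟩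
  have := hgeom j
  rw [mul_pow, mul_assoc] at this
  exact (Nat.eq_of_mul_eq_mul_left
    (pow_pos (Nat.pos_of_ne_zero (left_ne_zero_of_mul hd)) j) this).symm

namespace Subfield

variable [Field U]

theorem relfinrank_sup_iterate_map_geometric (σ : U →+* U) (A : Subfield U) {d : ℕ} (hd : d ≠ 0)
    (hstab : ∀ k, (compositum σ A k).relfinrank (compositum σ A (k + 1)) = d) :
    ∃ m, 0 < m ∧ m ∣ d ∧ ∃ k₀, ∀ j, A.relfinrank (A ⊔ (map σ)^[k₀ + j] A) =
      m ^ j * A.relfinrank (A ⊔ (map σ)^[k₀] A) := by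
  refine Nat.eventually_geometric_of_monotone hd
    (relfinrank_sup_iterate_map_ne_zero σ A ((hstab 0).trans_ne hd))
    (relfinrank_sup_iterate_map_monotone σ A hd hstab) fun k => ?_
  rw [← relfinrank_sup_iterate_map_succ σ A hd hstab k, mul_comm,
    relfinrank_mul_relfinrank le_sup_left le_sup_left, mul_comm,
    relfinrank_mul_relfinrank le_sup_left (sup_le_sup_right le_sup_left _)]

/-- Enlarging `A` to a finite extension changes the degrees `[A · σᵏ(A) : A]` by a bounded
factor. -/
theorem relfinrank_sup_iterate_map_le_mul (σ : U →+* U) {A B : Subfield U} (hAB : A ≤ B)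
    (h : A.relfinrank B ≠ 0) {k : ℕ} (hk : B.relfinrank (B ⊔ (map σ)^[k] B) ≠ 0) :
    A.relfinrank (A ⊔ (map σ)^[k] A) ≤ A.relfinrank B * B.relfinrank (B ⊔ (map σ)^[k] B) := by
  have hk' := mul_ne_zero h hk
  rw [relfinrank_mul_relfinrank hAB le_sup_left] at hk' ⊢
  exact relfinrank_le_of_le_right le_sup_left (sup_le_sup hAB (iterate_map_mono σ A hAB k)) hk'

theorem relfinrank_sup_iterate_map_le_mul' (σ : U →+* U) {A B : Subfield U} (hAB : A ≤ B)
    (h : A.relfinrank B ≠ 0) {k : ℕ} (hk : A.relfinrank (A ⊔ (map σ)^[k] A) ≠ 0) :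
    B.relfinrank (B ⊔ (map σ)^[k] B) ≤ A.relfinrank B * A.relfinrank (A ⊔ (map σ)^[k] A) := by
  have hle : B ⊔ (map σ)^[k] A ≤ B ⊔ (map σ)^[k] B :=
    sup_le_sup_left (iterate_map_mono σ A hAB k) _
  have h₁ := (relfinrank_baseChange (C := B) (D := B ⊔ (map σ)^[k] A) le_sup_left hAB le_sup_left
    (sup_le le_sup_right (le_sup_right.trans le_sup_left)) hk).2
  have h₂ := (relfinrank_baseChange (C := B ⊔ (map σ)^[k] A) (iterate_map_mono σ A hAB k)
    le_sup_right hle (sup_le (le_sup_left.trans le_sup_right) le_sup_left)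
    ((relfinrank_iterate_map σ A k).trans_ne h)).2
  rw [relfinrank_iterate_map] at h₂
  rw [← relfinrank_mul_relfinrank le_sup_left hle, mul_comm]
  exact Nat.mul_le_mul h₂ h₁

end Subfield

theorem tendsto_mul_pow_rpow_one_div {C m : ℝ} (hC : 0 < C) (hm : 0 < m) :
    Tendsto (fun k : ℕ => (C * m ^ k) ^ (1 / (k : ℝ))) atTop (nhds m) := by
  have h₁ : Tendsto (fun k : ℕ => C ^ (1 / (k : ℝ)) * m) atTop (nhds (C ^ (0 : ℝ) * m)) :=
    ((Real.continuousAt_const_rpow hC.ne').tendsto.comp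
      tendsto_one_div_atTop_nhds_zero_nat).mul_const m
  rw [Real.rpow_zero, one_mul] at h₁
  refine h₁.congr' ?_
  filter_upwards [eventually_ne_atTop 0] with k hk
  rw [Real.mul_rpow hC.le (pow_nonneg hm.le k), one_div, Real.pow_rpow_inv_natCast hm.le hk]

section Adjoin

variable [Field U]

theorem fAdj_eq_closure (E : Subfield U) (s : Set U) : fAdj E s = E ⊔ Subfield.closure s := by
  rw [fAdj, IntermediateField.adjoin_toSubfield, Subfield.closure_union,
    show Set.range (algebraMap E U) = (E : Set U) from Subtype.range_coe, Subfield.closure_eq]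

theorem le_fAdj (E : Subfield U) (s : Set U) : E ≤ fAdj E s :=
  fAdj_eq_closure E s ▸ le_sup_left

theorem deg_eq_relfinrank (E : Subfield U) (s : Set U) : deg E s = E.relfinrank (fAdj E s) := by
  rw [deg, Subfield.relfinrank_eq_finrank_of_le (le_fAdj E s)]
  rfl

theorem fAdj_fAdj (K : Subfield U) (s t : Set U) : fAdj (fAdj K s) t = fAdj K s ⊔ fAdj K t := by
  simp only [fAdj_eq_closure]
  rw [sup_assoc, sup_sup_distrib_left]

variable (σ : U ≃+* U) {K : Subfield U} (hK : K.map σ.toRingHom = K)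

include hK

theorem fAdj_image (s : Set U) : fAdj K (σ '' s) = (fAdj K s).map σ.toRingHom := by
  rw [fAdj_eq_closure, fAdj_eq_closure, Subfield.map_sup, hK, RingHom.map_field_closure]
  rfl

theorem fAdj_image_pow (s : Set U) (k : ℕ) :
    fAdj K (⇑(σ ^ k) '' s) = (Subfield.map σ.toRingHom)^[k] (fAdj K s) := by
  induction k with
  | zero => simp
  | succ k ih =>
    rw [Subfield.iterate_map_succ, ← ih, ← fAdj_image σ hK, ← Set.image_comp, pow_succ']
    rfl

theorem fAdj_biUnion_image_pow (s : Set U) (k : ℕ) :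
    fAdj K (⋃ i ∈ Set.Iic k, ⇑(σ ^ i) '' s) =
      Subfield.compositum σ.toRingHom (fAdj K s) k := by
  induction k with
  | zero => simp [Subfield.compositum]
  | succ k ih =>
    rw [Subfield.compositum_succ, ← ih, ← fAdj_image_pow σ hK, ← fAdj_fAdj, fAdj_eq_closure,
      fAdj_eq_closure, fAdj_eq_closure, sup_assoc, ← Subfield.closure_union, ← Order.succ_eq_add_one,
      Order.Iic_succ, Set.biUnion_insert, Set.union_comm]

theorem ldSeq_eq_relfinrank (s : Set U) (k : ℕ) :
    ldSeq σ K s k = (Subfield.compositum σ.toRingHom (fAdj K s) k).relfinrank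
      (Subfield.compositum σ.toRingHom (fAdj K s) (k + 1)) := by
  rw [ldSeq, deg_eq_relfinrank, fAdj_fAdj, fAdj_biUnion_image_pow σ hK, fAdj_image_pow σ hK,
    Subfield.compositum_succ]

theorem ddSeq_eq_relfinrank (s : Set U) (k : ℕ) :
    ddSeq σ K s k = (fAdj K s).relfinrank
      (fAdj K s ⊔ (Subfield.map σ.toRingHom)^[k] (fAdj K s)) := by
  rw [ddSeq, deg_eq_relfinrank, fAdj_fAdj, fAdj_image_pow σ hK]

end Adjoin

/-- `dd(a/K)` is a positive integer dividing `ld(a/K)`. -/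
theorem stmt13 [Field U] [IsAlgClosed U] (σ : U ≃+* U) (K : Subfield U)
    (hK : K.map σ.toRingHom = K) {n : ℕ} (a : Fin n → U)
    (ha : ∀ i, IsAlgebraic (fAdj K (Set.range a)) (σ (a i)))
    (La : ℕ) (hLa : ∀ᶠ k in atTop, ldSeq σ K (Set.range a) k = La)
    (Da : ℝ)
    (hDa : Tendsto (fun k => (ddSeq σ K (Set.range a) k : ℝ) ^ (1 / (k : ℝ)))
      atTop (nhds Da)) :
    ∃ m : ℕ, 0 < m ∧ (m : ℝ) = Da ∧ m ∣ La := by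
  set A := fAdj K (Set.range a) with hA
  set τ := σ.toRingHom
  have hfin : A.relfinrank (A ⊔ A.map τ) ≠ 0 := by
    rw [← fAdj_image σ hK, hA, ← fAdj_fAdj, ← deg_eq_relfinrank, deg]
    have : FiniteDimensional (fAdj K (range a))
        (IntermediateField.adjoin (fAdj K (range a)) (σ '' range a)) := by
      have : Finite (σ '' range a) := ((finite_range a).image σ).to_subtype
      refine IntermediateField.finiteDimensional_adjoin ?_
      rintro _ ⟨_, ⟨i, rfl⟩, rfl⟩
      exact (ha i).isIntegral
    exact Module.finrank_pos.ne'
  obtain ⟨k₁, hk₁⟩ := eventually_atTop.mp hLa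
  simp only [ldSeq_eq_relfinrank σ hK] at hk₁
  have hLa0 : La ≠ 0 :=
    hk₁ k₁ le_rfl ▸ Subfield.relfinrank_compositum_succ_ne_zero τ A hfin k₁
  set B := Subfield.compositum τ A k₁ with hB
  have hstab (k : ℕ) : (Subfield.compositum τ B k).relfinrank
      (Subfield.compositum τ B (k + 1)) = La := by
    rw [hB, Subfield.compositum_compositum, Subfield.compositum_compositum, Nat.add_right_comm]
    exact hk₁ _ (Nat.le_add_left _ _)
  have hAB : A ≤ B := Subfield.le_compositum τ A k₁
  have he : A.relfinrank B ≠ 0 := Subfield.relfinrank_compositum_ne_zero τ A hfin k₁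
  obtain ⟨m, hm, hmd, k₀, hgeom⟩ := Subfield.relfinrank_sup_iterate_map_geometric τ B hLa0 hstab
  refine ⟨m, hm, ?_, hmd⟩
  have hBne := Subfield.relfinrank_sup_iterate_map_ne_zero τ B ((hstab 0).trans_ne hLa0)
  have hAne := Subfield.relfinrank_sup_iterate_map_ne_zero τ A hfin
  set e := A.relfinrank B
  set N := B.relfinrank (B ⊔ (Subfield.map τ)^[k₀] B)
  have hm' : (0 : ℝ) < m := by exact_mod_cast hm
  have he' : (0 : ℝ) < e := by exact_mod_cast Nat.pos_of_ne_zero he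
  have hN' : (0 : ℝ) < N := by exact_mod_cast Nat.pos_of_ne_zero (hBne k₀)
  have hbound : ∀ᶠ k in atTop,
      N / (m : ℝ) ^ k₀ / e * (m : ℝ) ^ k ≤ ddSeq σ K (range a) k ∧
      (ddSeq σ K (range a) k : ℝ) ≤ e * (N / (m : ℝ) ^ k₀) * (m : ℝ) ^ k := by
    filter_upwards [eventually_ge_atTop k₀] with k hk
    obtain ⟨j, rfl⟩ := Nat.exists_eq_add_of_le hk
    rw [ddSeq_eq_relfinrank σ hK]
    have h₁ := Subfield.relfinrank_sup_iterate_map_le_mul τ hAB he (hBne (k₀ + j))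
    have h₂ := Subfield.relfinrank_sup_iterate_map_le_mul' τ hAB he (hAne (k₀ + j))
    rw [hgeom] at h₁ h₂
    have h₁' : (A.relfinrank (A ⊔ (Subfield.map τ)^[k₀ + j] A) : ℝ) ≤ e * ((m : ℝ) ^ j * N) := by
      exact_mod_cast h₁
    have h₂' : (m : ℝ) ^ j * N ≤ e * (A.relfinrank (A ⊔ (Subfield.map τ)^[k₀ + j] A) : ℝ) := by
      exact_mod_cast h₂
    constructor
    · rw [div_div, div_mul_eq_mul_div, div_le_iff₀ (by positivity), pow_add]
      calc (N : ℝ) * (m ^ k₀ * m ^ j) = m ^ k₀ * (m ^ j * N) := by ring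
        _ ≤ m ^ k₀ * (e * _) := by gcongr
        _ = _ := by ring
    · refine h₁'.trans_eq ?_
      rw [pow_add]
      field_simp
  refine tendsto_nhds_unique (tendsto_of_tendsto_of_tendsto_of_le_of_le'
    (tendsto_mul_pow_rpow_one_div (C := N / (m : ℝ) ^ k₀ / e) (by positivity) hm')
    (tendsto_mul_pow_rpow_one_div (C := e * (N / (m : ℝ) ^ k₀)) (by positivity) hm') ?_ ?_) hDa
  · filter_upwards [hbound] with k hk
    exact Real.rpow_le_rpow (by positivity) hk.1 (by positivity)
  · filter_upwards [hbound] with k hk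
    exact Real.rpow_le_rpow (by positivity) hk.2 (by positivity)
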